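/- Let n ≥ 1, let U ⊆ ℂⁿ be open, let φ : U → ℝ be twice continuously differentiable, and define g : U × ℂ → ℝ by g(z, w) = |w|² − exp(φ(z)). Let p = (z, w) ∈ U × ℂ satisfy |w|² = exp(φ(z)), and let (u, c) ∈ ℂⁿ × ℂ satisfy the complex tangency condition −exp(φ(z))·∂φ(z)(u) + w̄·c = 0. Then H_g(p)(u, c) = −exp(φ(z))·H_φ(z)(u). -/

import Mathlib

open Complex

/-- The complex Hessian quadratic form of `f` at `p` evaluated on `v`:
`H_f(p)(v) = (1/4) * (D²f(p)(v,v) + D²f(p)(iv,iv))`. -/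
noncomputable def cHess {E : Type*} [NormedAddCommGroup E] [NormedSpace ℂ E]
    (f : E → ℝ) (p v : E) : ℝ :=
  (1 / 4) * (fderiv ℝ (fderiv ℝ f) p v v + fderiv ℝ (fderiv ℝ f) p (I • v) (I • v))

/-- The (1,0)-differential of `f` at `p` applied to `v`:
`∂f(p)(v) = (1/2) * (Df(p)(v) - i·Df(p)(iv))`. -/
noncomputable def del10 {E : Type*} [NormedAddCommGroup E] [NormedSpace ℂ E]
    (f : E → ℝ) (p v : E) : ℂ :=
  (1 / 2) * (((fderiv ℝ f p v : ℝ) : ℂ) - I * ((fderiv ℝ f p (I • v) : ℝ) : ℂ))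

/-- The second derivative of `q ↦ ‖Q q‖² - exp (φ (P q))`, for continuous linear `P` and `Q`, on the
diagonal. -/
theorem fderiv_fderiv_norm_sq_sub_exp {G E F : Type*}
    [NormedAddCommGroup G] [NormedSpace ℝ G]
    [NormedAddCommGroup E] [NormedSpace ℝ E] [NormedAddCommGroup F] [InnerProductSpace ℝ F]
    (P : G →L[ℝ] E) (Q : G →L[ℝ] F) {φ : E → ℝ} {p : G} (hφ : ContDiffAt ℝ 2 φ (P p)) (v : G) :
    fderiv ℝ (fderiv ℝ fun q => ‖Q q‖ ^ 2 - Real.exp (φ (P q))) p v v =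
      2 * ‖Q v‖ ^ 2 - Real.exp (φ (P p)) *
        (fderiv ℝ (fderiv ℝ φ) (P p) (P v) (P v) + fderiv ℝ φ (P p) (P v) ^ 2) := by
  obtain ⟨A, hA⟩ : ∃ A : G →L[ℝ] G →L[ℝ] ℝ, ∀ q r, A q r = 2 * inner ℝ (Q q) (Q r) := by
    let B : F →L[ℝ] F →L[ℝ] ℝ := innerSL ℝ
    refine ⟨(2 : ℝ) • B.bilinearComp Q Q, fun q r => ?_⟩
    simp only [smul_apply, ContinuousLinearMap.bilinearComp_apply, smul_eq_mul]
    rfl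
  have hev : ∀ᶠ y in nhds (P p), DifferentiableAt ℝ φ y :=
    (hφ.eventually (by simp)).mono fun y hy => hy.differentiableAt (by norm_num)
  have hgrad : (fderiv ℝ fun q => ‖Q q‖ ^ 2 - Real.exp (φ (P q))) =ᶠ[nhds p]
      fun q => A q - Real.exp (φ (P q)) • (fderiv ℝ φ (P q)).comp P := by
    filter_upwards [P.continuous.continuousAt.eventually hev] with q hq
    have h : HasFDerivAt (fun q => ‖Q q‖ ^ 2) (A q) q := by
      convert (Q.hasFDerivAt (x := q)).norm_sq using 1
      ext r
      simp [hA]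
    exact (h.sub (hq.hasFDerivAt.comp q P.hasFDerivAt).exp).fderiv
  have hD : DifferentiableAt ℝ (fderiv ℝ φ) (P p) :=
    (hφ.fderiv_right (m := 1) (by norm_num)).differentiableAt (by norm_num)
  have h₁ : HasFDerivAt (fun q => (fderiv ℝ φ (P q)).comp P) _ p :=
    (HasFDerivAt.comp p hD.hasFDerivAt P.hasFDerivAt).clm_comp (hasFDerivAt_const P p)
  have h₂ : HasFDerivAt (fun q => Real.exp (φ (P q))) _ p :=
    (HasFDerivAt.comp p hev.self_of_nhds.hasFDerivAt P.hasFDerivAt).exp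
  rw [hgrad.fderiv_eq, (A.hasFDerivAt.fun_sub (h₂.fun_smul h₁)).fderiv]
  simp [hA]
  ring

theorem four_mul_norm_sq_del10 {E : Type*} [NormedAddCommGroup E] [NormedSpace ℂ E]
    (f : E → ℝ) (p v : E) :
    4 * ‖del10 f p v‖ ^ 2 = fderiv ℝ f p v ^ 2 + fderiv ℝ f p (I • v) ^ 2 := by
  rw [← normSq_eq_norm_sq, normSq_apply]
  simp [del10]
  ring

theorem cHess_norm_sq_snd_sub_exp_fst {E : Type*} [NormedAddCommGroup E] [NormedSpace ℂ E]
    {φ : E → ℝ} {z : E} (hφ : ContDiffAt ℝ 2 φ z) (w : ℂ) (u : E) (c : ℂ) :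
    cHess (fun q : E × ℂ => ‖q.2‖ ^ 2 - Real.exp (φ q.1)) (z, w) (u, c) =
      ‖c‖ ^ 2 - Real.exp (φ z) * (cHess φ z u + ‖del10 φ z u‖ ^ 2) := by
  have h₁ := fderiv_fderiv_norm_sq_sub_exp (ContinuousLinearMap.fst ℝ E ℂ)
    (ContinuousLinearMap.snd ℝ E ℂ) (p := (z, w)) hφ (u, c)
  have h₂ := fderiv_fderiv_norm_sq_sub_exp (ContinuousLinearMap.fst ℝ E ℂ)
    (ContinuousLinearMap.snd ℝ E ℂ) (p := (z, w)) hφ (I • (u, c))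
  simp only [ContinuousLinearMap.coe_fst', ContinuousLinearMap.coe_snd', Prod.smul_fst,
    Prod.smul_snd, norm_smul, norm_I, one_mul] at h₁ h₂
  have hd := four_mul_norm_sq_del10 φ z u
  unfold cHess
  erw [h₁, h₂]
  linear_combination (-1 / 4 * Real.exp (φ z)) * -hd

/-- on the hypersurface `{|w|² = exp(φ(z))}`, for complex tangent vectors,
the complex Hessian of `g` reduces to `-exp(φ(z))·H_φ(z)(u)`. -/
theorem hessian_on_complex_tangent_space
    (n : ℕ) (hn : 1 ≤ n) (U : Set (EuclideanSpace ℂ (Fin n))) (hU : IsOpen U)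
    (φ : EuclideanSpace ℂ (Fin n) → ℝ) (hφ : ContDiffOn ℝ 2 φ U)
    (g : EuclideanSpace ℂ (Fin n) × ℂ → ℝ)
    (hg : ∀ z w, g (z, w) = ‖w‖ ^ 2 - Real.exp (φ z))
    (z : EuclideanSpace ℂ (Fin n)) (hz : z ∈ U) (w : ℂ)
    (hw : ‖w‖ ^ 2 = Real.exp (φ z))
    (u : EuclideanSpace ℂ (Fin n)) (c : ℂ)
    (htan : -(Real.exp (φ z) : ℂ) * del10 φ z u + (starRingEnd ℂ) w * c = 0) :
    cHess g (z, w) (u, c) = -Real.exp (φ z) * cHess φ z u := by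
  obtain rfl : g = fun q => ‖q.2‖ ^ 2 - Real.exp (φ q.1) := funext fun q => hg q.1 q.2
  have hnorm : Real.exp (φ z) * ‖del10 φ z u‖ = ‖w‖ * ‖c‖ := by
    have h : (Real.exp (φ z) : ℂ) * del10 φ z u = (starRingEnd ℂ) w * c := by
      linear_combination -htan
    simpa [-ofReal_exp, abs_of_pos (Real.exp_pos _)] using congrArg norm h
  have hc : ‖c‖ ^ 2 = Real.exp (φ z) * ‖del10 φ z u‖ ^ 2 := by
    apply mul_left_cancel₀ (Real.exp_pos (φ z)).ne'
    calc Real.exp (φ z) * ‖c‖ ^ 2 = (‖w‖ * ‖c‖) ^ 2 := by rw [← hw]; ring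
      _ = Real.exp (φ z) * (Real.exp (φ z) * ‖del10 φ z u‖ ^ 2) := by rw [← hnorm]; ring
  have hH := cHess_norm_sq_snd_sub_exp_fst (hφ.contDiffAt (hU.mem_nhds hz)) w u c
  rw [hH, hc]
  ring
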